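/- Let p, p' ∈ 𝔓_>([L]) and let Y be an orthogonal real L×L matrix satisfying Σ_{i=1}^L p(i)^{-1/2} δ_i^{⊗3} = (Y⊗Y⊗Y)(Σ_{i=1}^L p'(i)^{-1/2} δ_i^{⊗3}). Then Y is a permutation matrix, and p(i) = p'(j) whenever Y_{ij} = 1. -/

import Mathlib

open scoped BigOperators

/-- `p` is a probability distribution on `Fin L`. -/
def probDist {L : ℕ} (p : Fin L → ℝ) : Prop :=
  (∀ i, 0 ≤ p i) ∧ ∑ i, p i = 1

/-- `p` is a probability distribution on `Fin L` with all entries strictly positive. -/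
def probPos {L : ℕ} (p : Fin L → ℝ) : Prop :=
  (∀ i, 0 < p i) ∧ ∑ i, p i = 1

/-- `p^{(K)}`: the function on `[L]^K` equal to `p i` on the constant tuple `(i,…,i)`
and `0` elsewhere. -/
def diagEmbed {L : ℕ} (p : Fin L → ℝ) (K : ℕ) : (Fin K → Fin L) → ℝ :=
  fun y => ∑ i, if (∀ k, y k = i) then p i else 0

/-- The action of `X_1 ⊗ … ⊗ X_K` on functions `[L]^K → ℝ`. -/
def tensorAct {L L' K : ℕ} (X : Fin K → Matrix (Fin L') (Fin L) ℝ)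
    (v : (Fin K → Fin L) → ℝ) : (Fin K → Fin L') → ℝ :=
  fun y => ∑ x : Fin K → Fin L, v x * ∏ k, X k (y k) (x k)

/-- A channel from `[L]` to `[L']`: an `L' × L` column-stochastic matrix. -/
def isChannel {L L' : ℕ} (W : Matrix (Fin L') (Fin L) ℝ) : Prop :=
  (∀ i j, 0 ≤ W i j) ∧ ∀ j, ∑ i, W i j = 1

/-- The permutation matrix `P_τ` with `P_τ δ_j = δ_{τ j}`. -/
def permMat {L : ℕ} (τ : Equiv.Perm (Fin L)) : Matrix (Fin L) (Fin L) ℝ :=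
  fun i j => if i = τ j then 1 else 0

theorem diagEmbed_const {L K : ℕ} (hK : 0 < K) (q : Fin L → ℝ) (y : Fin K → Fin L) :
    diagEmbed q K y = if ∀ k, y k = y ⟨0, hK⟩ then q (y ⟨0, hK⟩) else 0 := by
  unfold diagEmbed
  rw [Finset.sum_eq_single (y ⟨0, hK⟩)]
  · intro i _ hi
    exact if_neg fun h => hi (h ⟨0, hK⟩).symm
  · simp

theorem tensorAct_diagEmbed {L L' K : ℕ} (X : Fin K → Matrix (Fin L') (Fin L) ℝ)
    (q : Fin L → ℝ) (y : Fin K → Fin L') :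
    tensorAct X (diagEmbed q K) y = ∑ j, q j * ∏ k, X k (y k) j := by
  unfold tensorAct diagEmbed
  simp only [Finset.sum_mul]
  rw [Finset.sum_comm]
  refine Finset.sum_congr rfl fun j _ => ?_
  rw [Finset.sum_eq_single (fun _ => j)]
  · simp
  · intro x _ hx
    rw [if_neg fun h => hx (funext h), zero_mul]
  · simp

/-- Contracting the last leg of a diagonal three-tensor identity against a column of an
orthogonal matrix. -/
theorem diag_contract_column {L : ℕ} (a b : Fin L → ℝ) (Y : Matrix (Fin L) (Fin L) ℝ)
    (hY : Y.transpose * Y = 1)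
    (heq : diagEmbed a 3 = tensorAct (fun _ : Fin 3 => Y) (diagEmbed b 3)) (i j k : Fin L) :
    (if i = j then a i * Y i k else 0) = b k * (Y i k * Y j k) := by
  have hentry : ∀ c, (if j = i ∧ c = i then a i else 0)
      = ∑ l, b l * (Y i l * Y j l * Y c l) := by
    intro c
    have h := congrFun heq ![i, j, c]
    rw [tensorAct_diagEmbed, diagEmbed_const (by norm_num)] at h
    simpa [Fin.forall_fin_succ, Fin.prod_univ_three] using h
  have horth : ∀ l, ∑ c, Y c l * Y c k = if l = k then 1 else 0 := by
    intro l
    have h := congrFun (congrFun hY l) k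
    simpa [Matrix.mul_apply, Matrix.one_apply] using h
  calc (if i = j then a i * Y i k else 0)
      = ∑ c, (if j = i ∧ c = i then a i else 0) * Y c k := by
        by_cases h : i = j
        · simp [h]
        · simp [h, Ne.symm h]
    _ = ∑ c, ∑ l, b l * (Y i l * Y j l) * (Y c l * Y c k) := by
        refine Finset.sum_congr rfl fun c _ => ?_
        rw [hentry, Finset.sum_mul]
        exact Finset.sum_congr rfl fun l _ => by ring
    _ = b k * (Y i k * Y j k) := by
        rw [Finset.sum_comm]
        simp [← Finset.mul_sum, horth]

theorem orthogonal_solution_is_permutation (L : ℕ) (hL : 1 ≤ L)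
    (p p' : Fin L → ℝ) (hp : probPos p) (hp' : probPos p')
    (Y : Matrix (Fin L) (Fin L) ℝ) (hY : Y * Y.transpose = 1)
    (heq : diagEmbed (fun i => (Real.sqrt (p i))⁻¹) 3
      = tensorAct (fun _ : Fin 3 => Y)
          (diagEmbed (fun i => (Real.sqrt (p' i))⁻¹) 3)) :
    (∃ τ : Equiv.Perm (Fin L), Y = permMat τ)
    ∧ (∀ i j, Y i j = 1 → p i = p' j) := by
  have hY' : Y.transpose * Y = 1 := mul_eq_one_comm.mp hY
  have hcol := diag_contract_column _ _ Y hY' heq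
  have ha : ∀ i, 0 < (Real.sqrt (p i))⁻¹ := fun i => inv_pos.mpr (Real.sqrt_pos.mpr (hp.1 i))
  have hb : ∀ i, 0 < (Real.sqrt (p' i))⁻¹ := fun i => inv_pos.mpr (Real.sqrt_pos.mpr (hp'.1 i))
  have horth : ∀ l k, ∑ c, Y c l * Y c k = if l = k then 1 else 0 := by
    intro l k
    have h := congrFun (congrFun hY' l) k
    simpa [Matrix.mul_apply, Matrix.one_apply] using h
  have hoff : ∀ i j k, i ≠ j → Y i k * Y j k = 0 := by
    intro i j k hij
    have h := hcol i j k
    rw [if_neg hij] at h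
    exact (mul_eq_zero.mp h.symm).resolve_left (hb k).ne'
  have hdiag : ∀ i k, (Real.sqrt (p i))⁻¹ * Y i k = (Real.sqrt (p' k))⁻¹ * (Y i k * Y i k) := by
    intro i k
    simpa using hcol i i k
  have hex : ∀ k, ∃ i, Y i k = 1 ∧ ∀ j, j ≠ i → Y j k = 0 := by
    intro k
    have hk := horth k k
    rw [if_pos rfl] at hk
    obtain ⟨i, -, hi⟩ := Finset.exists_ne_zero_of_sum_ne_zero (hk.trans_ne one_ne_zero)
    have hi0 : Y i k ≠ 0 := fun h => hi (by simp [h])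
    have hz : ∀ j, j ≠ i → Y j k = 0 := fun j hj =>
      (mul_eq_zero.mp (hoff j i k hj)).resolve_right hi0
    refine ⟨i, ?_, hz⟩
    rw [Finset.sum_eq_single i (fun j _ hj => by simp [hz j hj]) (by simp)] at hk
    have hd := hdiag i k
    rw [hk, mul_one] at hd
    have hpos : 0 < Y i k := pos_of_mul_pos_right (hd ▸ hb k) (ha i).le
    nlinarith
  choose f hf1 hf0 using hex
  have hinj : Function.Injective f := by
    intro l k hlk
    by_contra hne
    have h := horth l k
    rw [if_neg hne, Finset.sum_eq_single (f l) (fun j _ hj => by simp [hf0 l j hj]) (by simp),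
      hf1 l, hlk, hf1 k] at h
    norm_num at h
  refine ⟨⟨Equiv.ofBijective f (Finite.injective_iff_bijective.mp hinj), ?_⟩, ?_⟩
  · ext i k
    simp only [permMat, Equiv.ofBijective_apply]
    split_ifs with h
    · rw [h, hf1]
    · exact hf0 k i h
  · intro i j hij
    have h := hdiag i j
    rw [hij, mul_one, mul_one, mul_one] at h
    exact (Real.sqrt_inj (hp.1 i).le (hp'.1 j).le).mp (inv_injective h)
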